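/- Let π = ∏_{j=1}^{m} t_{k_j}^{i_{k_j}} be a standard OGS elementary element of S_n (2 ≤ k_1 < ⋯ < k_m ≤ n, 0 < i_{k_j} < k_j, ρ₁ := Σ_{j=1}^{m} i_{k_j} ≤ k_1). Let x and i_x be integers with 0 < i_x < x and x ≤ k_1 − ρ₁. Then π·t_x^{i_x} = t_{ρ₁+i_x}^{ρ₁}·t_{ρ₁+x}^{i_x}·π. -/

import Mathlib

/-!
Setup for the symmetric group `Sₙ`, realized as `Equiv.Perm (Fin n)` with `Fin n`
encoding `{1, …, n}` (0-indexed positions).  The paper multiplies permutations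
left-to-right: `(π·σ)(i) = σ(π(i))`, while Mathlib composes right-to-left:
`(π * σ) i = π (σ i)`.  Hence a paper product `a₁ · a₂ ⋯ a_k` is encoded as the
Mathlib product `a_k * ⋯ * a₂ * a₁` (the leftmost paper factor acts first).
-/

open Equiv Finset

/-- The adjacent transposition `sᵢ` (1-indexed values): the transposition `(i, i+1)`,
as a permutation of `Fin n`; junk value `1` outside the range `1 ≤ i ≤ n-1`. -/
def sP (n : ℕ) (i : ℕ) : Equiv.Perm (Fin n) :=
  if h : i < n then Equiv.swap ⟨i - 1, by omega⟩ ⟨i, h⟩ else 1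

/-- `tₘ = s₁·s₂⋯s_{m−1}` (left-to-right), i.e. the `m`-cycle sending `1 ↦ m` and
`j ↦ j−1` for `2 ≤ j ≤ m` (1-indexed), fixing every `j > m`; `t₁ = 1`. -/
def tP (n : ℕ) (m : ℕ) : Equiv.Perm (Fin n) :=
  if h : m - 1 < n then ((⟨m - 1, h⟩ : Fin n).cycleRange)⁻¹ else 1

/-- The paper's left-to-right product `f a · f (a+1) ⋯ f b` (increasing indices,
so `f a` acts first), encoded in Mathlib's composition order. -/
def ogsProd {n : ℕ} (a b : ℕ) (f : ℕ → Equiv.Perm (Fin n)) : Equiv.Perm (Fin n) :=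
  ((List.range' a (b + 1 - a)).map f).reverse.prod

/-- The paper's left-to-right product `f b · f (b−1) ⋯ f a` (decreasing indices,
so `f b` acts first), encoded in Mathlib's composition order. -/
def ogsProdDesc {n : ℕ} (a b : ℕ) (f : ℕ → Equiv.Perm (Fin n)) : Equiv.Perm (Fin n) :=
  ((List.range' a (b + 1 - a)).map f).prod

/-- The Coxeter length of `π`: the number of inversions, i.e. of pairs `i < j`
with `π(i) > π(j)`. -/
def len {n : ℕ} (π : Equiv.Perm (Fin n)) : ℕ :=
  (Finset.univ.filter fun p : Fin n × Fin n => p.1 < p.2 ∧ π p.2 < π p.1).card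

/-- The descent set of `π`: the set of 1-indexed positions `i ∈ {1, …, n−1}`
with `π(i) > π(i+1)`. -/
def descents {n : ℕ} (π : Equiv.Perm (Fin n)) : Finset ℕ :=
  (Finset.Ico 1 n).filter fun i => ∃ h : i < n, π ⟨i, h⟩ < π ⟨i - 1, by omega⟩

theorem tP_apply_val {n m : ℕ} (hm : 1 ≤ m) (hmn : m ≤ n) (v : Fin n) :
    (tP n m v : ℕ) = if (v : ℕ) < m then (if (v : ℕ) = 0 then m - 1 else v - 1) else v := by
  have hlt : m - 1 < n := by omega
  let w : Fin n := ⟨if (v : ℕ) < m then (if (v : ℕ) = 0 then m - 1 else v - 1) else v, by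
    split_ifs <;> omega⟩
  suffices h : tP n m v = w from congrArg Fin.val h
  rw [tP, dif_pos hlt, Equiv.Perm.inv_eq_iff_eq]
  ext
  rcases lt_trichotomy (w : ℕ) (m - 1) with h | h | h
  · rw [Fin.coe_cycleRange_of_lt (Fin.lt_def.2 h)]
    simp only [w] at h ⊢
    split_ifs at h ⊢ <;> omega
  · have hw : w = ⟨m - 1, hlt⟩ := Fin.ext h
    rw [Fin.coe_cycleRange_of_le hw.le, if_pos hw]
    simp only [w] at h
    split_ifs at h <;> omega
  · rw [Fin.cycleRange_of_gt (Fin.lt_def.2 h)]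
    simp only [w] at h ⊢
    split_ifs at h ⊢ <;> omega

theorem tP_pow_apply_val {n m i : ℕ} (hm : 1 ≤ m) (hmn : m ≤ n) (him : i ≤ m) (v : Fin n) :
    ((tP n m ^ i) v : ℕ) =
      if (v : ℕ) < m then (if (v : ℕ) < i then v + m - i else v - i) else v := by
  induction i with
  | zero => simp
  | succ i ih =>
    rw [pow_succ', Equiv.Perm.mul_apply, tP_apply_val hm hmn, ih (by omega)]
    split_ifs <;> omega

theorem ogsProd_succ {n a b : ℕ} (h : a ≤ b + 1) (f : ℕ → Equiv.Perm (Fin n)) :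
    ogsProd a (b + 1) f = f (b + 1) * ogsProd a b f := by
  have hlen : b + 1 + 1 - a = (b + 1 - a) + 1 := by omega
  have hlast : a + (b + 1 - a) = b + 1 := by omega
  simp [ogsProd, hlen, List.range'_concat, hlast]

/-- An elementary element shifts the positions between its exponent sum and its smallest
index down by the exponent sum. -/
theorem ogsProd_tP_pow_apply_val {n K m : ℕ} {k i : ℕ → ℕ}
    (hk : ∀ j, 1 ≤ j → j ≤ m → K ≤ k j ∧ k j ≤ n)
    {v : Fin n} (hv : ∑ j ∈ Finset.Icc 1 m, i j ≤ v) (hvK : (v : ℕ) < K) :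
    (ogsProd 1 m (fun j => tP n (k j) ^ i j) v : ℕ) = v - ∑ j ∈ Finset.Icc 1 m, i j := by
  induction m with
  | zero => simp [ogsProd]
  | succ m ih =>
    rw [Finset.sum_Icc_succ_top (by omega)] at hv ⊢
    have hlast := hk (m + 1) (by omega) le_rfl
    rw [ogsProd_succ (by omega), Equiv.Perm.mul_apply,
      tP_pow_apply_val (by omega) hlast.2 (by omega),
      ih (fun j h1 h2 => hk j h1 (by omega)) (by omega)]
    split_ifs <;> omega

/-- A permutation shifting the interval `[r, r + x)` down to `[0, x)` exchanges with powers of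
`tP n x`. -/
theorem tP_pow_mul_of_shift {n r x a : ℕ} (hxn : r + x ≤ n) (ha : 0 < a) (hax : a < x)
    (π : Equiv.Perm (Fin n)) (hπ : ∀ v : Fin n, r ≤ v → (v : ℕ) < r + x → (π v : ℕ) = v - r) :
    tP n x ^ a * π = π * tP n (r + x) ^ a * tP n (r + a) ^ r := by
  have hout : ∀ v : Fin n, (π v : ℕ) < x → r ≤ v ∧ (v : ℕ) < r + x := by
    intro v hv
    have hw : π ⟨π v + r, by omega⟩ = π v :=
      Fin.ext (by rw [hπ] <;> simp; omega)
    have := congrArg Fin.val (π.injective hw)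
    simp only at this
    omega
  ext v
  have hu : ((tP n (r + x) ^ a * tP n (r + a) ^ r) v : ℕ) =
      if r ≤ (v : ℕ) ∧ (v : ℕ) < r + x then
        (if (v : ℕ) < r + a then v + x - a else v - a) else v := by
    rw [Equiv.Perm.mul_apply, tP_pow_apply_val (by omega) hxn (by omega),
      tP_pow_apply_val (by omega) (by omega) (by omega)]
    split_ifs <;> omega
  rw [mul_assoc, Equiv.Perm.mul_apply, Equiv.Perm.mul_apply π,
    tP_pow_apply_val (by omega) (by omega) hax.le]
  by_cases h : r ≤ (v : ℕ) ∧ (v : ℕ) < r + x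
  · rw [if_pos h] at hu
    rw [hπ v h.1 h.2, hπ _ (by split_ifs at hu <;> omega) (by split_ifs at hu <;> omega), hu]
    split_ifs <;> omega
  · rw [if_neg h] at hu
    rw [if_neg (fun hlt => h (hout v hlt)), Fin.ext hu]

/-- Let `π = ∏_{j=1}^{m} t_{k_j}^{i_j}` be a standard OGS elementary
element of `Sₙ` with `ρ₁ = Σ_{j=1}^{m} i_j ≤ k₁`, and let `0 < i_x < x` with
`x ≤ k₁ − ρ₁`.  Then `π·t_x^{i_x} = t_{ρ₁+i_x}^{ρ₁}·t_{ρ₁+x}^{i_x}·π`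
(paper products, encoded in reversed Mathlib order). -/
theorem elementary_exchange (n m : ℕ) (k i : ℕ → ℕ) (hm : 1 ≤ m)
    (hk : ∀ j, 1 ≤ j → j ≤ m → 2 ≤ k j ∧ k j ≤ n)
    (hmono : ∀ j, 1 ≤ j → j < m → k j < k (j + 1))
    (hi : ∀ j, 1 ≤ j → j ≤ m → 0 < i j ∧ i j < k j)
    (hsum : ∑ j ∈ Finset.Icc 1 m, i j ≤ k 1)
    (x ix : ℕ) (hix0 : 0 < ix) (hix : ix < x)
    (hx : x ≤ k 1 - ∑ j ∈ Finset.Icc 1 m, i j)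
    (π : Equiv.Perm (Fin n)) (hπ : π = ogsProd 1 m fun j => tP n (k j) ^ i j) :
    tP n x ^ ix * π =
      π * tP n ((∑ j ∈ Finset.Icc 1 m, i j) + x) ^ ix *
        tP n ((∑ j ∈ Finset.Icc 1 m, i j) + ix) ^ (∑ j ∈ Finset.Icc 1 m, i j) := by
  have hk1 : ∀ j, 1 ≤ j → j ≤ m → k 1 ≤ k j := by
    intro j h1
    induction j, h1 using Nat.le_induction with
    | base => exact fun _ => le_rfl
    | succ j h1 ih => exact fun hj => (ih (by omega)).trans (hmono j h1 (by omega)).le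
  have hkn := (hk 1 le_rfl hm).2
  refine tP_pow_mul_of_shift (by omega) hix0 hix π fun v hv hvx => ?_
  rw [hπ]
  exact ogsProd_tP_pow_apply_val (fun j h1 h2 => ⟨hk1 j h1 h2, (hk j h1 h2).2⟩) hv
    (hvx.trans_le (by omega))
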